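/- Suppose U, V₁, V₂, V₃ are Banach spaces, U is finite-dimensional, γ > 0, γ₀ is the largest integer strictly smaller than γ, and f : U → L(V₁, V₂), g : U → L(V₂, V₃) are Lip(γ) functions. Let h : U → L(V₁, V₃) be defined by h(u) := g(u) ∘ f(u). Then h is γ₀-times continuously differentiable, and there exists a constant K₂ > 0, depending only on γ and the dimension of U, such that for all u₁, u₂ ∈ U, ‖h^{(γ₀)}(u₁) − h^{(γ₀)}(u₂)‖ ≤ K₂ · ‖f‖_{Lip(γ)} · ‖g‖_{Lip(γ)} · ‖u₁ − u₂‖^{γ−γ₀}. -/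

import Mathlib

/-- `steinDeg γ` is the largest integer strictly smaller than `γ` (for `γ > 0`). -/
noncomputable def steinDeg (γ : ℝ) : ℕ := ⌈γ⌉₊ - 1

/-- The set of admissible bounds `M` in Stein's definition of a `Lip(γ)` function:
`M ≥ 0` bounds all iterated Fréchet derivatives up to order `γ₀ = steinDeg γ`, and the
`γ₀`-th derivative is `(γ - γ₀)`-Hölder with constant `M`. -/
def lipBoundSet (γ : ℝ) {U W : Type*} [NormedAddCommGroup U] [NormedSpace ℝ U]
    [NormedAddCommGroup W] [NormedSpace ℝ W] (f : U → W) : Set ℝ :=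
  {M | 0 ≤ M ∧
    (∀ k ≤ steinDeg γ, ∀ u : U, ‖iteratedFDeriv ℝ k f u‖ ≤ M) ∧
    (∀ u₁ u₂ : U,
      ‖iteratedFDeriv ℝ (steinDeg γ) f u₁ - iteratedFDeriv ℝ (steinDeg γ) f u₂‖
        ≤ M * ‖u₁ - u₂‖ ^ (γ - (steinDeg γ : ℝ)))}

/-- `f` is `Lip(γ)` in the sense of Stein: `γ₀`-times continuously differentiable and
there is an admissible bound `M`. -/
def IsLipGamma (γ : ℝ) {U W : Type*} [NormedAddCommGroup U] [NormedSpace ℝ U]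
    [NormedAddCommGroup W] [NormedSpace ℝ W] (f : U → W) : Prop :=
  ContDiff ℝ (steinDeg γ) f ∧ (lipBoundSet γ f).Nonempty

/-- The `Lip(γ)` norm of `f`: the smallest admissible bound `M`. -/
noncomputable def lipGammaNorm (γ : ℝ) {U W : Type*} [NormedAddCommGroup U] [NormedSpace ℝ U]
    [NormedAddCommGroup W] [NormedSpace ℝ W] (f : U → W) : ℝ :=
  sInf (lipBoundSet γ f)

open Set Finset

theorem steinDeg_lt {γ : ℝ} (hγ : 0 < γ) : (steinDeg γ : ℝ) < γ := by
  have h1 : 1 ≤ ⌈γ⌉₊ := Nat.one_le_ceil_iff.mpr hγ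
  have h2 := Nat.ceil_lt_add_one hγ.le
  rw [steinDeg, Nat.cast_sub h1, Nat.cast_one]
  linarith

theorem sub_steinDeg_le_one (γ : ℝ) : γ - steinDeg γ ≤ 1 := by
  have h1 := Nat.le_ceil γ
  have h2 : (⌈γ⌉₊ : ℝ) ≤ steinDeg γ + 1 := by
    rw [steinDeg]
    exact_mod_cast (by omega : ⌈γ⌉₊ ≤ ⌈γ⌉₊ - 1 + 1)
  linarith

section

variable {U W : Type*} [NormedAddCommGroup U] [NormedSpace ℝ U]
  [NormedAddCommGroup W] [NormedSpace ℝ W]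

theorem isClosed_lipBoundSet (γ : ℝ) (f : U → W) : IsClosed (lipBoundSet γ f) := by
  simp only [lipBoundSet, ofPred_and, ofPred_forall]
  refine isClosed_Ici.inter (IsClosed.inter ?_ ?_)
  · exact isClosed_iInter fun k => isClosed_iInter fun _ => isClosed_iInter fun u => isClosed_Ici
  · exact isClosed_iInter fun u₁ => isClosed_iInter fun u₂ =>
      isClosed_le continuous_const (by fun_prop)

theorem IsLipGamma.lipGammaNorm_mem {γ : ℝ} {f : U → W} (hf : IsLipGamma γ f) :
    lipGammaNorm γ f ∈ lipBoundSet γ f :=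
  (isClosed_lipBoundSet γ f).csInf_mem hf.2 ⟨0, fun _ hM => hM.1⟩

/-- The lower derivatives of a `Lip(γ)` function are Hölder with the same exponent as the top one. -/
theorem norm_iteratedFDeriv_sub_le_of_mem_lipBoundSet {γ : ℝ} (hγ : 0 < γ) {f : U → W}
    (hf : ContDiff ℝ (steinDeg γ) f) {M : ℝ} (hM : M ∈ lipBoundSet γ f)
    {k : ℕ} (hk : k ≤ steinDeg γ) (x y : U) :
    ‖iteratedFDeriv ℝ k f x - iteratedFDeriv ℝ k f y‖
      ≤ 2 * M * ‖x - y‖ ^ (γ - (steinDeg γ : ℝ)) := by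
  obtain ⟨hM0, hMb, hMh⟩ := hM
  have hα : 0 < γ - (steinDeg γ : ℝ) := sub_pos.mpr (steinDeg_lt hγ)
  have hpow : 0 ≤ ‖x - y‖ ^ (γ - (steinDeg γ : ℝ)) := by positivity
  rcases hk.eq_or_lt with rfl | hlt
  · nlinarith [hMh x y, mul_nonneg hM0 hpow]
  rcases le_total ‖x - y‖ 1 with hxy | hxy
  · have hmv : ‖iteratedFDeriv ℝ k f x - iteratedFDeriv ℝ k f y‖ ≤ M * ‖x - y‖ := by
      refine convex_univ.norm_image_sub_le_of_norm_fderiv_le (𝕜 := ℝ) (fun z _ => ?_)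
        (fun z _ => ?_) (mem_univ y) (mem_univ x)
      · exact (hf.differentiable_iteratedFDeriv (by exact_mod_cast hlt)) z
      · rw [norm_fderiv_iteratedFDeriv]
        exact hMb (k + 1) hlt z
    have hle : ‖x - y‖ ≤ ‖x - y‖ ^ (γ - (steinDeg γ : ℝ)) :=
      Real.self_le_rpow_of_le_one (norm_nonneg _) hxy (sub_steinDeg_le_one γ)
    nlinarith [mul_le_mul_of_nonneg_left hle hM0, mul_nonneg hM0 hpow]
  · have hle : 1 ≤ ‖x - y‖ ^ (γ - (steinDeg γ : ℝ)) := Real.one_le_rpow hxy hα.le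
    have htri := norm_sub_le (iteratedFDeriv ℝ k f x) (iteratedFDeriv ℝ k f y)
    nlinarith [hMb k hk x, hMb k hk y, mul_le_mul_of_nonneg_left hle hM0]

theorem iteratedFDeriv_comp_add_sub {n k : ℕ} {f : U → W} (hf : ContDiff ℝ n f) (hk : k ≤ n)
    (v x : U) : iteratedFDeriv ℝ k (fun u => f (u + v) - f u) x
      = iteratedFDeriv ℝ k f (x + v) - iteratedFDeriv ℝ k f x := by
  have hf' : ContDiff ℝ k f := hf.of_le (by exact_mod_cast hk)
  have hfv : ContDiff ℝ k (fun u => f (u + v)) := hf'.comp (contDiff_id.add contDiff_const)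
  rw [fun_iteratedFDeriv_sub_apply hfv.contDiffAt hf'.contDiffAt, iteratedFDeriv_comp_add_right]

end

/-- A crude form of the Leibniz rule: uniform bounds on the derivatives of both factors. -/
theorem ContinuousLinearMap.norm_iteratedFDeriv_bilinear_le {U E F G : Type*}
    [NormedAddCommGroup U] [NormedSpace ℝ U] [NormedAddCommGroup E] [NormedSpace ℝ E]
    [NormedAddCommGroup F] [NormedSpace ℝ F] [NormedAddCommGroup G] [NormedSpace ℝ G]
    (B : E →L[ℝ] F →L[ℝ] G) (hB : ‖B‖ ≤ 1) {n : ℕ} {f : U → E} {g : U → F}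
    (hf : ContDiff ℝ n f) (hg : ContDiff ℝ n g) {x : U} {a b : ℝ}
    (ha : ∀ k ≤ n, ‖iteratedFDeriv ℝ k f x‖ ≤ a) (hb : ∀ k ≤ n, ‖iteratedFDeriv ℝ k g x‖ ≤ b) :
    ‖iteratedFDeriv ℝ n (fun u => B (f u) (g u)) x‖ ≤ 2 ^ n * (a * b) := by
  have ha0 : 0 ≤ a := (norm_nonneg _).trans (ha 0 n.zero_le)
  calc _ ≤ ∑ i ∈ range (n + 1), (n.choose i : ℝ) * ‖iteratedFDeriv ℝ i f x‖
          * ‖iteratedFDeriv ℝ (n - i) g x‖ :=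
        B.norm_iteratedFDeriv_le_of_bilinear_of_le_one hf hg x le_rfl hB
    _ ≤ ∑ i ∈ range (n + 1), (n.choose i : ℝ) * (a * b) := by
        refine sum_le_sum fun i hi => ?_
        rw [mul_assoc]
        have h1 := ha i (Nat.lt_succ_iff.mp (mem_range.mp hi))
        have h2 := hb (n - i) (n.sub_le i)
        gcongr
    _ = 2 ^ n * (a * b) := by
        rw [← sum_mul, ← Nat.cast_sum, Nat.sum_range_choose, Nat.cast_pow, Nat.cast_ofNat]

/-- A bilinear product of `Lip(γ)` functions has a Hölder continuous top derivative. -/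
theorem norm_iteratedFDeriv_bilinear_sub_le {U E F G : Type*}
    [NormedAddCommGroup U] [NormedSpace ℝ U] [NormedAddCommGroup E] [NormedSpace ℝ E]
    [NormedAddCommGroup F] [NormedSpace ℝ F] [NormedAddCommGroup G] [NormedSpace ℝ G]
    (B : E →L[ℝ] F →L[ℝ] G) (hB : ‖B‖ ≤ 1) {γ : ℝ} (hγ : 0 < γ) {f : U → E} {g : U → F}
    (hf : IsLipGamma γ f) (hg : IsLipGamma γ g) (x y : U) :
    ‖iteratedFDeriv ℝ (steinDeg γ) (fun u => B (f u) (g u)) x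
        - iteratedFDeriv ℝ (steinDeg γ) (fun u => B (f u) (g u)) y‖
      ≤ 4 * 2 ^ steinDeg γ * lipGammaNorm γ f * lipGammaNorm γ g
          * ‖x - y‖ ^ (γ - (steinDeg γ : ℝ)) := by
  have hfM := hf.lipGammaNorm_mem
  have hgM := hg.lipGammaNorm_mem
  obtain ⟨v, rfl⟩ : ∃ v, x = y + v := ⟨x - y, by abel⟩
  have hfv : ContDiff ℝ (steinDeg γ) (fun u => f (u + v)) :=
    hf.1.comp (contDiff_id.add contDiff_const)
  have hgv : ContDiff ℝ (steinDeg γ) (fun u => g (u + v)) :=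
    hg.1.comp (contDiff_id.add contDiff_const)
  have hdf := hfv.sub hf.1
  have hdg := hgv.sub hg.1
  have hsplit : (fun u => B (f (u + v)) (g (u + v)) - B (f u) (g u))
      = fun u => B (f (u + v)) (g (u + v) - g u) + B (f (u + v) - f u) (g u) := by
    ext1 u
    simp only [map_sub, sub_apply]
    abel
  have h1 := B.norm_iteratedFDeriv_bilinear_le hB hfv hdg (x := y)
    (fun k hk => by rw [iteratedFDeriv_comp_add_right]; exact hfM.2.1 k hk _)
    (fun k hk => by
      rw [iteratedFDeriv_comp_add_sub hg.1 hk]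
      exact norm_iteratedFDeriv_sub_le_of_mem_lipBoundSet hγ hg.1 hgM hk _ _)
  have h2 := B.norm_iteratedFDeriv_bilinear_le hB hdf hg.1 (x := y)
    (fun k hk => by
      rw [iteratedFDeriv_comp_add_sub hf.1 hk]
      exact norm_iteratedFDeriv_sub_le_of_mem_lipBoundSet hγ hf.1 hfM hk _ _)
    (fun k hk => hgM.2.1 k hk _)
  have hprod : ContDiff ℝ (steinDeg γ) (fun u => B (f u) (g u)) :=
    B.isBoundedBilinearMap.contDiff.comp (hf.1.prodMk hg.1)
  have hprod₁ : ContDiff ℝ (steinDeg γ) (fun u => B (f (u + v)) (g (u + v) - g u)) :=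
    B.isBoundedBilinearMap.contDiff.comp (hfv.prodMk hdg)
  have hprod₂ : ContDiff ℝ (steinDeg γ) (fun u => B (f (u + v) - f u) (g u)) :=
    B.isBoundedBilinearMap.contDiff.comp (hdf.prodMk hg.1)
  rw [← iteratedFDeriv_comp_add_sub hprod le_rfl, hsplit,
    fun_iteratedFDeriv_add_apply hprod₁.contDiffAt hprod₂.contDiffAt]
  refine (norm_add_le _ _).trans ((add_le_add h1 h2).trans_eq ?_)
  ring

/-- If `U` is a finite-dimensional Banach space, `V₁, V₂, V₃` are Banach
spaces, and `f : U → L(V₁,V₂)`, `g : U → L(V₂,V₃)` are `Lip(γ)`, then the pointwise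
composition `h(u) = g(u) ∘ f(u)` is `γ₀`-times continuously differentiable, and there is a
constant `K₂ > 0`, depending only on `γ` and (the dimension of) `U`, such that the `γ₀`-th
derivative of `h` satisfies the `(γ - γ₀)`-Hölder bound
`‖h^(γ₀)(u₁) - h^(γ₀)(u₂)‖ ≤ K₂ ‖f‖_{Lip(γ)} ‖g‖_{Lip(γ)} ‖u₁ - u₂‖^(γ-γ₀)`. -/
theorem lipGamma_comp_top_derivative_holder (γ : ℝ) (hγ : 0 < γ)
    (U : Type) [NormedAddCommGroup U] [NormedSpace ℝ U] [CompleteSpace U]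
    [FiniteDimensional ℝ U] :
    ∃ K₂ : ℝ, 0 < K₂ ∧
      ∀ (V₁ V₂ V₃ : Type)
        [NormedAddCommGroup V₁] [NormedSpace ℝ V₁] [CompleteSpace V₁]
        [NormedAddCommGroup V₂] [NormedSpace ℝ V₂] [CompleteSpace V₂]
        [NormedAddCommGroup V₃] [NormedSpace ℝ V₃] [CompleteSpace V₃]
        (f : U → V₁ →L[ℝ] V₂) (g : U → V₂ →L[ℝ] V₃),
        IsLipGamma γ f → IsLipGamma γ g →
          ContDiff ℝ (steinDeg γ) (fun u => (g u).comp (f u)) ∧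
          ∀ u₁ u₂ : U,
            ‖iteratedFDeriv ℝ (steinDeg γ) (fun u => (g u).comp (f u)) u₁
                - iteratedFDeriv ℝ (steinDeg γ) (fun u => (g u).comp (f u)) u₂‖
              ≤ K₂ * lipGammaNorm γ f * lipGammaNorm γ g
                  * ‖u₁ - u₂‖ ^ (γ - (steinDeg γ : ℝ)) := by
  refine ⟨4 * 2 ^ steinDeg γ, by positivity, fun V₁ V₂ V₃ => ?_⟩
  intro _ _ _ _ _ _ _ _ _ f g hf hg
  refine ⟨hg.1.clm_comp hf.1, fun u₁ u₂ => ?_⟩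
  have h := norm_iteratedFDeriv_bilinear_sub_le (ContinuousLinearMap.compL ℝ V₁ V₂ V₃)
    (ContinuousLinearMap.norm_compL_le ℝ V₁ V₂ V₃) hγ hg hf u₁ u₂
  rwa [mul_right_comm (4 * 2 ^ steinDeg γ : ℝ)] at h
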